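/- arXiv:1508.02318 — 2 statements merged into one kernel-verified Lean document; each statement's English description precedes it below -/
import Mathlib

section
/- Let g be a natural number, let G be the abelian group ℤ^{2g} × ℤ/2ℤ, let k be a field of characteristic different from 2, and let Γ ≤ G be any subgroup of index 2. Then for every natural number n there is a k-linear isomorphism between the group cohomology H^n(Γ; k) and H^n(G; k), where k carries the trivial action in both cases. -/
open CategoryTheory Rep

namespace groupCohomology

universe u

variable {k G : Type u} [CommRing k] [CommGroup G]

/-- The action of an element of a commutative group as an endomorphism of a complex of
representations. -/
def complexApplyAsHom (P : ChainComplex (Rep k G) ℕ) (g : G) : P ⟶ P where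
  f i := (P.X i).applyAsHom g
  comm' _ _ _ := applyAsHom_comm _ _

/-- The action of `g` on a projective resolution of the trivial representation is homotopic to the
identity, since it lifts the identity. -/
noncomputable def complexApplyAsHomHomotopy (P : ProjectiveResolution (trivial k G k)) (g : G) :
    Homotopy (complexApplyAsHom P.complex g) (𝟙 P.complex) :=
  ProjectiveResolution.liftHomotopy (𝟙 _) _ _
    (by
      ext : 1
      change (P.complex.X 0).applyAsHom g ≫ P.π.f 0 = P.π.f 0 ≫ 𝟙 _
      rw [applyAsHom_comm]
      congr 1) (by simp)

lemma homologyMap_eq_id_of_homotopy {C ι : Type*} [Category* C] [Preadditive C]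
    [CategoryWithHomology C] {c : ComplexShape ι} {K L : HomologicalComplex C c} (e : K ≅ L)
    {f : K ⟶ K} {f' : L ⟶ L} (comm : e.inv ≫ f = f' ≫ e.inv) (h : Homotopy f' (𝟙 L)) (n : ι) :
    HomologicalComplex.homologyMap f n = 𝟙 _ := by
  rw [← cancel_epi (HomologicalComplex.homologyMap e.inv n),
    ← HomologicalComplex.homologyMap_comp, comm, HomologicalComplex.homologyMap_comp,
    h.homologyMap_eq n, HomologicalComplex.homologyMap_id, Category.id_comp, Category.comp_id]

/-- A commutative group acts trivially on its own cohomology. -/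
theorem map_applyAsHom (A : Rep k G) (g : G) (n : ℕ) :
    (functor k G n).map (A.applyAsHom g) = 𝟙 _ := by
  let F := ((linearYoneda k (Rep k G)).obj A).rightOp
  let h := (F.mapHomotopy (complexApplyAsHomHomotopy (barResolution k G) g)).unop
  refine homologyMap_eq_id_of_homotopy (inhomogeneousCochainsIso A) ?_
    (h.trans (.ofEq ?_)) n
  · ext i : 1
    refine ModuleCat.hom_ext (LinearMap.ext fun (x : (barComplex k G).X i ⟶ A) =>
      funext fun j => ?_)
    exact (hom_comm_apply x g (Finsupp.single j (MonoidAlgebra.single 1 1))).symm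
  · rw [CategoryTheory.Functor.map_id]
    exact CategoryTheory.Functor.map_id _ _

instance functor_additive (n : ℕ) : (functor k G n).Additive :=
  inferInstanceAs (cochainsFunctor k G ⋙ HomologicalComplex.homologyFunctor _ _ n).Additive

variable (S : Subgroup G)

/-- The inclusion of the trivial representation in the coinduced one as constant functions. -/
noncomputable def trivialToCoind : trivial k G k ⟶ coind S.subtype (trivial k S k) :=
  ofHom
    { toFun x := ⟨fun _ => x, by simp⟩
      map_add' _ _ := rfl
      map_smul' _ _ := rfl
      isIntertwining' g := rfl }

lemma coind_apply_eq (φ : coind S.subtype (trivial k S k)) {a b : G}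
    (h : (a : G ⧸ S) = b) : φ.1 a = φ.1 b := by
  have := φ.2 ⟨a⁻¹ * b, QuotientGroup.eq.1 h⟩ a
  simpa using this.symm

variable [Fintype (G ⧸ S)]

lemma sum_coind_out (φ : coind S.subtype (trivial k S k)) (g : G) :
    ∑ q : G ⧸ S, φ.1 (g * q.out) = ∑ q : G ⧸ S, φ.1 q.out :=
  Fintype.sum_equiv (MulAction.toPerm (β := G ⧸ S) g) _ _ fun q => coind_apply_eq S φ (by
    change ((g * q.out : G) : G ⧸ S) = ((g • q).out : G)
    rw [QuotientGroup.out_eq']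
    conv_rhs => rw [← QuotientGroup.out_eq' q]
    rfl)

/-- Summation over the cosets of `S`, as a map from the coinduced representation to the trivial
one. -/
noncomputable def coindToTrivial : coind S.subtype (trivial k S k) ⟶ trivial k G k :=
  ofHom
    { toFun φ := ∑ q : G ⧸ S, φ.1 q.out
      map_add' _ _ := by simp [Finset.sum_add_distrib]
      map_smul' _ _ := by simp [Finset.mul_sum]
      isIntertwining' g := by
        ext φ
        have := sum_coind_out S φ g
        simpa [mul_comm] using this }

lemma trivialToCoind_comp_coindToTrivial :
    trivialToCoind S ≫ coindToTrivial S = S.index • 𝟙 (trivial k G k) := by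
  ext
  change ∑ _ : G ⧸ S, (1 : k) = S.index • (1 : k)
  simp [Subgroup.index, Nat.card_eq_fintype_card]

lemma coindToTrivial_comp_trivialToCoind :
    coindToTrivial S ≫ trivialToCoind S =
      ∑ q : G ⧸ S, (coind S.subtype (trivial k S k)).applyAsHom q.out := by
  ext φ : 3
  refine Subtype.ext (funext fun h => ?_)
  rw [Rep.sum_hom, Representation.IntertwiningMap.toLinearMap_sum, LinearMap.sum_apply,
    Submodule.coe_sum, Finset.sum_apply]
  exact (sum_coind_out S φ h).symm

theorem map_trivialToCoind_comp (n : ℕ) :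
    (functor k G n).map (trivialToCoind S) ≫ (functor k G n).map (coindToTrivial S) =
      S.index • 𝟙 _ := by
  rw [← Functor.map_comp, trivialToCoind_comp_coindToTrivial, Functor.map_nsmul,
    CategoryTheory.Functor.map_id]

theorem map_coindToTrivial_comp (n : ℕ) :
    (functor k G n).map (coindToTrivial S) ≫ (functor k G n).map (trivialToCoind S) =
      S.index • 𝟙 _ := by
  rw [← Functor.map_comp, coindToTrivial_comp_trivialToCoind, Functor.map_sum]
  simp only [map_applyAsHom, Subgroup.index, Nat.card_eq_fintype_card,
    Finset.sum_const, Finset.card_univ]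

/-- When the index of `S` is invertible in `k`, the inclusion of the constant functions is an
isomorphism on cohomology. -/
noncomputable def trivialIsoCoind (hS : IsUnit (S.index : k)) (n : ℕ) :
    (functor k G n).obj (trivial k G k) ≅
      (functor k G n).obj (coind S.subtype (trivial k S k)) where
  hom := (functor k G n).map (trivialToCoind S)
  inv := (↑hS.unit⁻¹ : k) • (functor k G n).map (coindToTrivial S)
  hom_inv_id := by
    rw [Linear.comp_smul, map_trivialToCoind_comp, ← Nat.cast_smul_eq_nsmul k, smul_smul,
      IsUnit.val_inv_mul, one_smul]
  inv_hom_id := by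
    rw [Linear.smul_comp, map_coindToTrivial_comp, ← Nat.cast_smul_eq_nsmul k, smul_smul,
      IsUnit.val_inv_mul, one_smul]

/-- When the index of `S` is invertible in `k`, the groups `S` and `G` have isomorphic cohomology
with trivial coefficients. -/
noncomputable def trivialIsoOfIsUnitIndex (hS : IsUnit (S.index : k)) (n : ℕ) :
    groupCohomology (trivial k S k) n ≅ groupCohomology (trivial k G k) n :=
  (coindIso (trivial k S k) n).symm ≪≫ (trivialIsoCoind S hS n).symm

end groupCohomology

/-- For `G = ℤ^{2g} × ℤ/2ℤ`, `k` a field of characteristic `≠ 2`, and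
`Γ ≤ G` a subgroup of index two, the group cohomology `Hⁿ(Γ; k)` is `k`-linearly isomorphic
to `Hⁿ(G; k)` for every `n` (trivial coefficients in both cases). -/
theorem stmt2 (g : ℕ) (k : Type) [Field k] (hchar : ringChar k ≠ 2)
    (Γ : AddSubgroup ((Fin (2 * g) → ℤ) × ZMod 2)) (hΓ : Γ.index = 2) (n : ℕ) :
    Nonempty ((groupCohomology (Rep.trivial k (Multiplicative Γ) k) n) ≃ₗ[k]
      (groupCohomology
        (Rep.trivial k (Multiplicative ((Fin (2 * g) → ℤ) × ZMod 2)) k) n)) := by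
  let S : Subgroup (Multiplicative ((Fin (2 * g) → ℤ) × ZMod 2)) := Γ.toSubgroup
  have hS : S.index = 2 := (AddSubgroup.index_toSubgroup Γ).trans hΓ
  have : S.FiniteIndex := ⟨by simp [hS]⟩
  have := Fintype.ofFinite (Multiplicative ((Fin (2 * g) → ℤ) × ZMod 2) ⧸ S)
  have hu : IsUnit (S.index : k) := by
    rw [hS]
    exact (Ring.two_ne_zero hchar).isUnit
  exact ⟨(groupCohomology.trivialIsoOfIsUnitIndex S hu n).toLinearEquiv⟩
end

section
/- Let g be a natural number, let G be the abelian group ℤ^{2g} × ℤ/2ℤ, and let k be a field of characteristic different from 2. Then for every natural number n, the group cohomology H^n(G; k) with trivial coefficients is a finite-dimensional k-vector space of dimension equal to the binomial coefficient C(2g, n). -/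
section

open CategoryTheory Rep

universe u

section
variable {C : Type*} [Category* C] [Abelian C] {R : Type*} [Ring R] [Linear R C]

/-- Precomposition with a chain map, as a map of complexes of morphisms into `Y`. -/
noncomputable def ChainComplex.linearYonedaObjMap {α : Type*} [AddRightCancelSemigroup α] [One α]
    {X X' : ChainComplex C α} (φ : X ⟶ X') (Y : C) :
    X'.linearYonedaObj R Y ⟶ X.linearYonedaObj R Y :=
  (HomologicalComplex.unopFunctor _ _).map
    ((((linearYoneda R C).obj Y).rightOp.mapHomologicalComplex _).map φ).op

theorem ChainComplex.linearYonedaObjMap_id {α : Type*} [AddRightCancelSemigroup α] [One α]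
    (X : ChainComplex C α) (Y : C) :
    linearYonedaObjMap (R := R) (𝟙 X) Y = 𝟙 _ := by
  ext i x
  exact Category.id_comp _

theorem ChainComplex.homologyMap_linearYonedaObjMap_eq {α : Type*}
    [AddRightCancelSemigroup α] [One α] {X X' : ChainComplex C α} {φ ψ : X ⟶ X'} (h : Homotopy φ ψ)
    (Y : C) (i : α) :
    HomologicalComplex.homologyMap (linearYonedaObjMap (R := R) φ Y) i =
      HomologicalComplex.homologyMap (linearYonedaObjMap (R := R) ψ Y) i :=
  ((((linearYoneda R C).obj Y).rightOp.mapHomotopy h).unop).homologyMap_eq i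
end

variable {k G : Type u} [CommRing k] [CommGroup G]

/-- The action of an element of a commutative group on a complex of representations. -/
@[simps]
noncomputable def Rep.complexApplyAsHom {ι : Type*} {c : ComplexShape ι}
    (P : HomologicalComplex (Rep k G) c) (t : G) : P ⟶ P where
  f i := applyAsHom (P.X i) t
  comm' _ _ _ := applyAsHom_comm _ _

/-- A group element acts on a projective resolution of the trivial representation by a map
homotopic to the identity. -/
noncomputable def Rep.homotopyApplyAsHomId (P : ProjectiveResolution (trivial k G k)) (t : G) :
    Homotopy (Rep.complexApplyAsHom P.complex t) (𝟙 P.complex) := by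
  refine ProjectiveResolution.liftHomotopy (𝟙 _) _ _ ?_ (by simp)
  rw [CategoryTheory.Functor.map_id, Category.comp_id]
  ext1
  simp only [HomologicalComplex.comp_f, Rep.complexApplyAsHom_f]
  rw [applyAsHom_comm]
  exact Category.comp_id _

theorem Rep.freeLiftLEquiv_symm_comp {k : Type*} {G : Type*} [CommRing k] [Monoid G] {X : Type*}
    {A B : Rep k G} (f : X → A) (φ : A ⟶ B) :
    (freeLiftLEquiv k G X A).symm f ≫ φ = (freeLiftLEquiv k G X B).symm (φ.hom ∘ f) := by
  refine free_ext _ _ _ _ _ fun i => ?_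
  simp [homEquiv]

theorem groupCohomology.cochainsMap_applyAsHom (A : Rep k G) (t : G) :
    cochainsMap (.id G) (applyAsHom A t) ≫ (inhomogeneousCochainsIso A).hom =
      (inhomogeneousCochainsIso A).hom ≫
        ChainComplex.linearYonedaObjMap (Rep.complexApplyAsHom (barComplex k G) t) A := by
  ext i x
  exact (freeLiftLEquiv_symm_comp x (applyAsHom A t)).symm.trans (applyAsHom_comm _ _).symm

theorem groupCohomology.map_applyAsHom_s6 (A : Rep k G) (t : G) (n : ℕ) :
    groupCohomology.map (.id G) (applyAsHom A t) n = 𝟙 _ := by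
  have key := ChainComplex.homologyMap_linearYonedaObjMap_eq (R := k)
    (homotopyApplyAsHomId (barResolution k G) t) A n
  rw [ChainComplex.linearYonedaObjMap_id, HomologicalComplex.homologyMap_id] at key
  let e := HomologicalComplex.homologyMap (inhomogeneousCochainsIso A).hom n
  have he := congr(HomologicalComplex.homologyMap $(cochainsMap_applyAsHom A t) n)
  rw [HomologicalComplex.homologyMap_comp, HomologicalComplex.homologyMap_comp] at he
  exact (cancel_mono e).1 <| he.trans <|
    congr(e ≫ $key).trans <| (Category.comp_id e).trans (Category.id_comp e).symm

theorem Int.exists_forall_add_one_sub_eq {A : Type*} [AddCommGroup A] (f : ℤ → A) :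
    ∃ F : ℤ → A, ∀ m, F (m + 1) - F m = f m := by
  let F (m : ℤ) : A := ∑ i ∈ Finset.Ico 0 m, f i - ∑ i ∈ Finset.Ico m 0, f i
  refine ⟨F, fun m => ?_⟩
  rcases le_or_gt 0 m with h | h
  · have h1 : Finset.Ico m 0 = ∅ := by simpa
    have h2 : Finset.Ico (m + 1) 0 = ∅ := Finset.Ico_eq_empty_of_le (by lia)
    have h3 : Finset.Ico 0 (m + 1) = insert m (Finset.Ico 0 m) := by ext; simp; lia
    simp [F, h1, h2, h3]
  · have h1 : Finset.Ico 0 m = ∅ := Finset.Ico_eq_empty_of_le h.le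
    have h2 : Finset.Ico 0 (m + 1) = ∅ := Finset.Ico_eq_empty_of_le (by lia)
    have h3 : Finset.Ico m 0 = insert m (Finset.Ico (m + 1) 0) := by ext; simp; lia
    simp [F, h1, h2, h3]

/-- The inclusion of the constants in the coinduction of the trivial representation. -/
noncomputable def Rep.constCoind (k : Type u) [CommRing k] (S : Subgroup G) :
    trivial k G k ⟶ coind S.subtype (trivial k S k) :=
  resCoindToHom S.subtype (trivial k G k) (trivial k S k) (Rep.ofHom ⟨LinearMap.id, fun _ => rfl⟩)

/-- The sequence `0 ⟶ k ⟶ Coind k ⟶ Coind k ⟶ 0` given by the constants and by `t - 1`. -/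
noncomputable def Rep.coindSequence (k : Type u) [CommRing k] (S : Subgroup G) (t : G) :
    ShortComplex (Rep k G) where
  X₁ := trivial k G k
  X₂ := coind S.subtype (trivial k S k)
  X₃ := coind S.subtype (trivial k S k)
  f := Rep.constCoind k S
  g := applyAsHom _ t - 𝟙 _
  zero := by
    refine Rep.hom_ext (Representation.IntertwiningMap.ext (LinearMap.ext fun x => ?_))
    exact Subtype.ext (funext fun _ => sub_self x)

theorem Rep.coindSequence_g_apply (S : Subgroup G) (t : G)
    (f : coind S.subtype (trivial k S k)) (h : G) :
    ((Rep.coindSequence k S t).g.hom f).1 h = f.1 (h * t) - f.1 h := rfl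

theorem Rep.coindSequence_shortExact (χ : G →* Multiplicative ℤ) (t : G)
    (ht : χ t = Multiplicative.ofAdd 1) : (Rep.coindSequence k χ.ker t).ShortExact := by
  have hdec (h : G) : h * (t ^ (χ h).toAdd)⁻¹ ∈ χ.ker := by
    simp only [MonoidHom.mem_ker, map_mul, map_inv, map_zpow, ht, ← ofAdd_zsmul]
    simp
  have hinv (f : coind χ.ker.subtype (trivial k χ.ker k)) (h : G) :
      f.1 h = f.1 (t ^ (χ h).toAdd) := by
    simpa using f.2 ⟨_, hdec h⟩ (t ^ (χ h).toAdd)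
  have hmono : Mono (Rep.coindSequence k χ.ker t).f := by
    rw [Rep.mono_iff_injective]
    intro x y hxy
    exact congr(($hxy).1 1)
  have hepi : Epi (Rep.coindSequence k χ.ker t).g := by
    rw [Rep.epi_iff_surjective]
    intro f
    obtain ⟨F, hF⟩ := Int.exists_forall_add_one_sub_eq (fun m : ℤ => f.1 (t ^ m))
    refine ⟨⟨fun h => F (χ h).toAdd, fun s h => ?_⟩, ?_⟩
    · have : χ s = 1 := s.2
      simp [this]
    · apply Subtype.ext
      funext h
      rw [Rep.coindSequence_g_apply, hinv f h]
      simp only [map_mul, ht]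
      exact hF _
  refine ⟨?_⟩
  rw [← ShortComplex.exact_map_iff_of_faithful _ (forget₂ (Rep k G) (ModuleCat k)),
    ShortComplex.moduleCat_exact_iff]
  intro (f : coind χ.ker.subtype (trivial k χ.ker k)) hf
  have hf' (h : G) : f.1 (h * t) = f.1 h := sub_eq_zero.1 congr(($hf).1 h)
  refine ⟨f.1 1, Subtype.ext (funext fun h => ?_)⟩
  change f.1 1 = f.1 h
  rw [hinv f h]
  clear hf
  generalize (χ h).toAdd = m
  induction m with
  | zero => simp
  | succ i ih => rw [zpow_add_one, hf']; exact ih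
  | pred i ih => rw [ih, ← hf' (t ^ (-(i : ℤ) - 1)), ← zpow_add_one, sub_add_cancel]

theorem groupCohomology.cochainsMap_id_sub {A B : Rep k G} (φ ψ : A ⟶ B) :
    cochainsMap (.id G) (φ - ψ) = cochainsMap (.id G) φ - cochainsMap (.id G) ψ := rfl

theorem groupCohomology.map_applyAsHom_sub_id (A : Rep k G) (t : G) (n : ℕ) :
    groupCohomology.map (.id G) (applyAsHom A t - 𝟙 A) n = 0 := by
  have h := map_applyAsHom_s6 A t n
  rw [← map_id] at h
  rw [groupCohomology.map, cochainsMap_id_sub, HomologicalComplex.homologyMap_sub]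
  exact sub_eq_zero.2 h

theorem groupCohomology.map_coindSequence_g (S : Subgroup G) (t : G) (n : ℕ) :
    (groupCohomology.functor k G n).map (coindSequence k S t).g = 0 :=
  map_applyAsHom_sub_id (coind S.subtype (trivial k S k)) t n

theorem groupCohomology.finrank_trivial_succ_of_surjective_int {k G : Type u} [Field k]
    [CommGroup G] (χ : G →* Multiplicative ℤ)
    (hχ : Function.Surjective χ) (n : ℕ)
    [FiniteDimensional k (groupCohomology (trivial k χ.ker k) n)]
    [FiniteDimensional k (groupCohomology (trivial k χ.ker k) (n + 1))] :
    FiniteDimensional k (groupCohomology (trivial k G k) (n + 1)) ∧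
    Module.finrank k (groupCohomology (trivial k G k) (n + 1)) =
    Module.finrank k (groupCohomology (trivial k χ.ker k) n) +
    Module.finrank k (groupCohomology (trivial k χ.ker k) (n + 1)) := by
  obtain ⟨t, ht⟩ := hχ (.ofAdd 1)
  have hX := Rep.coindSequence_shortExact (k := k) χ t ht
  let e (i : ℕ) := (coindIso (trivial k χ.ker k) i).toLinearEquiv
  have h₁ := mapShortComplex₁_exact hX (i := n) rfl
  have h₂ := mapShortComplex₂_exact hX (n + 1)
  have h₃ := mapShortComplex₃_exact hX (i := n) rfl
  let a : groupCohomology (coind χ.ker.subtype (trivial k χ.ker k)) n →ₗ[k]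
    groupCohomology (trivial k G k) (n + 1) := (δ hX n (n + 1) rfl).hom
  let b : groupCohomology (trivial k G k) (n + 1) →ₗ[k]
    groupCohomology (coind χ.ker.subtype (trivial k χ.ker k)) (n + 1) :=
    (groupCohomology.map (.id G) (Rep.coindSequence k χ.ker t).f (n + 1)).hom
  have ha : Function.Injective a := (ModuleCat.mono_iff_injective _).1 <|
    h₃.mono_g (map_coindSequence_g _ t n)
  have hb : Function.Surjective b := (ModuleCat.epi_iff_surjective _).1 <|
    h₂.epi_f (map_coindSequence_g _ t (n + 1))
  have hab : Function.Exact a b :=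
    (ShortComplex.ShortExact.moduleCat_exact_iff_function_exact _).1 h₁
  have := (e n).symm.finiteDimensional
  have := (e (n + 1)).symm.finiteDimensional
  have hfin : FiniteDimensional k (groupCohomology (trivial k G k) (n + 1)) :=
    Module.Finite.of_exact hab hb
  refine ⟨hfin, ?_⟩
  rw [← (e n).finrank_eq, ← (e (n + 1)).finrank_eq, ← b.finrank_range_add_finrank_ker, add_comm,
    hab.linearMap_ker_eq, LinearMap.finrank_range_of_inj ha, LinearMap.range_eq_top.2 hb, finrank_top]

theorem groupCohomology.finrank_trivial_zero {k G : Type u} [Field k] [Group G] :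
    FiniteDimensional k (groupCohomology (trivial k G k) 0) ∧
    Module.finrank k (groupCohomology (trivial k G k) 0) = 1 := by
  let e := (H0IsoOfIsTrivial (trivial k G k)).toLinearEquiv
  have : FiniteDimensional k (trivial k G k) := inferInstanceAs (FiniteDimensional k k)
  exact ⟨e.symm.finiteDimensional, e.finrank_eq.trans (Module.finrank_self k)⟩

theorem groupCohomology.isZero_succ_of_finite {k G : Type u} [Field k] [Group G] [Finite G]
    [NeZero (Nat.card G : k)]
    (A : Rep k G) (n : ℕ) :
    Limits.IsZero (groupCohomology A (n + 1)) :=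
  (isZero_Ext_succ_of_projective (trivial k G k) A n).of_iso <| groupCohomologyIsoExt _ _

theorem groupCohomology.finrank_trivial_of_surjective_pi_int {k : Type u} [Field k]
    (r : ℕ) {G : Type u} [CommGroup G]
    (χ : G →* Multiplicative (Fin r → ℤ)) (hχ : Function.Surjective χ) [Finite χ.ker]
    (hk : (Nat.card χ.ker : k) ≠ 0) (n : ℕ) :
    FiniteDimensional k (groupCohomology (trivial k G k) n) ∧
    Module.finrank k (groupCohomology (trivial k G k) n) = r.choose n := by
  induction r generalizing G n with
  | zero =>
    cases n with
    | zero => simpa using finrank_trivial_zero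
    | succ n =>
      have htop : χ.ker = ⊤ := top_le_iff.1 fun x _ => Subsingleton.elim _ _
      have : Finite G := by
        have : Finite (⊤ : Subgroup G) := htop ▸ ‹Finite χ.ker›
        exact Finite.of_equiv _ Subgroup.topEquiv.toEquiv
      have : NeZero (Nat.card G : k) := ⟨by rwa [htop, Subgroup.card_top] at hk⟩
      have := ModuleCat.subsingleton_of_isZero (isZero_succ_of_finite (trivial k G k) n)
      exact ⟨inferInstance, by simp [Module.finrank_zero_of_subsingleton]⟩
  | succ r ih =>
    cases n with
    | zero => simpa using finrank_trivial_zero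
    | succ n =>
      let p : G →* Multiplicative ℤ :=
        (Pi.evalAddMonoidHom (fun _ : Fin (r + 1) => ℤ) 0).toMultiplicative.comp χ
      let q : p.ker →* Multiplicative (Fin r → ℤ) :=
        ((LinearMap.funLeft ℤ ℤ Fin.succ).toAddMonoidHom.toMultiplicative.comp χ).comp
          p.ker.subtype
      have hp : Function.Surjective p := fun m => by
        obtain ⟨x, hx⟩ := hχ (.ofAdd fun _ => m.toAdd)
        exact ⟨x, by simp [p, hx]⟩
      have hq : Function.Surjective q := fun v => by
        obtain ⟨x, hx⟩ := hχ (.ofAdd (Fin.cons 0 v.toAdd))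
        exact ⟨⟨x, by simp [p, hx, MonoidHom.mem_ker]⟩, by
          apply Multiplicative.toAdd.injective; ext i; simp [q, hx, LinearMap.funLeft]⟩
      let e : q.ker ≃ χ.ker :=
        { toFun x := ⟨x.1.1, by
            have h1 : (χ x.1.1).toAdd 0 = 0 := x.1.2
            have h2 (i : Fin r) : (χ x.1.1).toAdd i.succ = 0 := congrFun x.2 i
            exact funext (Fin.cases h1 h2)⟩
          invFun x := ⟨⟨x.1, congrFun x.2 0⟩, funext fun i => congrFun x.2 i.succ⟩
          left_inv _ := rfl
          right_inv _ := rfl }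
      have : Finite q.ker := .of_equiv _ e.symm
      rw [← Nat.card_congr e] at hk
      have := (ih q hq hk n).1
      have := (ih q hq hk (n + 1)).1
      rw [Nat.choose_succ_succ, ← (ih q hq hk n).2, ← (ih q hq hk (n + 1)).2]
      exact finrank_trivial_succ_of_surjective_int p hp n

end

/-- For `G = ℤ^{2g} × ℤ/2ℤ` and `k` a field of characteristic `≠ 2`,
the group cohomology `Hⁿ(G; k)` with trivial coefficients is a finite-dimensional
`k`-vector space of dimension `C(2g, n)`. -/
theorem stmt6 (g : ℕ) (k : Type) [Field k] (hchar : ringChar k ≠ 2) (n : ℕ) :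
    FiniteDimensional k
      (groupCohomology
        (Rep.trivial k (Multiplicative ((Fin (2 * g) → ℤ) × ZMod 2)) k) n) ∧
    Module.finrank k
      (groupCohomology
        (Rep.trivial k (Multiplicative ((Fin (2 * g) → ℤ) × ZMod 2)) k) n) =
      (2 * g).choose n := by
  let χ := (AddMonoidHom.fst (Fin (2 * g) → ℤ) (ZMod 2)).toMultiplicative
  let e : χ.ker ≃ ZMod 2 :=
    { toFun x := x.1.toAdd.2
      invFun a := ⟨.ofAdd (0, a), rfl⟩
      left_inv x := Subtype.ext (Prod.ext (x.2 : χ x.1 = 1).symm rfl)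
      right_inv _ := rfl }
  have : Finite χ.ker := .of_equiv _ e.symm
  refine groupCohomology.finrank_trivial_of_surjective_pi_int (2 * g) χ
    (fun v => ⟨.ofAdd (v.toAdd, 0), rfl⟩) ?_ n
  rw [Nat.card_congr e, Nat.card_zmod]
  exact Ring.two_ne_zero hchar
end
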